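/- Let n ≥ 8. Then there exists no n×n real matrix M such that: (a) M is nonzero, symmetric, and positive semidefinite; (b) for every A ∈ 𝒜 and every x ∈ ℝⁿ, xᵀAᵀMAx ≤ xᵀMx; and (c) Me = 0, where e ∈ ℝⁿ is the all-ones vector. In other words, the class 𝒬 is empty for n ≥ 8. -/

import Mathlib

open Matrix

/-- A matrix is (row-)stochastic if its entries are nonnegative and each row sums to 1. -/
def IsStochastic {n : ℕ} (A : Matrix (Fin n) (Fin n) ℝ) : Prop :=
  (∀ i j, 0 ≤ A i j) ∧ (∀ i, ∑ j, A i j = 1)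

/-- The class `𝒜` of matrices of one iteration of the symmetric equal-neighbor algorithm:
stochastic matrices with (i) positive diagonal, (ii) all positive entries of a row equal,
(iii) symmetric sparsity pattern, (iv) connected associated graph (any two nodes are joined
by a path along pairs with positive entries). -/
def MemA {n : ℕ} (A : Matrix (Fin n) (Fin n) ℝ) : Prop :=
  IsStochastic A ∧
  (∀ i, 0 < A i i) ∧
  (∀ i j k, 0 < A i j → 0 < A i k → A i j = A i k) ∧
  (∀ i j, 0 < A i j ↔ 0 < A j i) ∧
  (∀ i j : Fin n, Relation.ReflTransGen (fun a b => 0 < A a b) i j)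

/-- The class `𝒬` of (matrices of) candidate quadratic Lyapunov functions: `M` is nonzero,
symmetric, positive semidefinite, `M e = 0` for the all-ones vector `e`, and
`(Ax)ᵀ M (Ax) ≤ xᵀ M x` for every `A ∈ 𝒜` and every `x`. -/
def MemQ {n : ℕ} (M : Matrix (Fin n) (Fin n) ℝ) : Prop :=
  M ≠ 0 ∧ M.IsSymm ∧ M.PosSemidef ∧
  M *ᵥ (fun _ => (1 : ℝ)) = 0 ∧
  ∀ A : Matrix (Fin n) (Fin n) ℝ, MemA A →
    ∀ x : Fin n → ℝ, (A *ᵥ x) ⬝ᵥ (M *ᵥ (A *ᵥ x)) ≤ x ⬝ᵥ (M *ᵥ x)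

/-- `P` is a permutation matrix: for some permutation `σ`, `(Px)_i = x_{σ(i)}` for all `x`. -/
def IsPermMatrix {n : ℕ} (P : Matrix (Fin n) (Fin n) ℝ) : Prop :=
  ∃ σ : Equiv.Perm (Fin n), ∀ (x : Fin n → ℝ) (i : Fin n), (P *ᵥ x) i = x (σ i)

/-- The permutation matrix of a permutation `σ`, satisfying `(Px)_i = x_{σ(i)}`. -/
def permMatrix {n : ℕ} (σ : Equiv.Perm (Fin n)) : Matrix (Fin n) (Fin n) ℝ :=
  fun i j => if j = σ i then 1 else 0

/-- The sample variance `V(x) = ∑ i (x_i - x̄)²` where `x̄` is the average of the `x_i`. -/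
noncomputable def sampleVar {n : ℕ} (x : Fin n → ℝ) : ℝ :=
  ∑ i, (x i - (∑ j, x j) / n) ^ 2

/-! ### Averaging a quadratic form over permutations -/

/-- The class `𝒜` is invariant under relabelling the nodes. -/
lemma MemA.submatrix {n : ℕ} {A : Matrix (Fin n) (Fin n) ℝ} (hA : MemA A)
    (σ : Equiv.Perm (Fin n)) : MemA (A.submatrix σ σ) := by
  obtain ⟨⟨hnonneg, hrow⟩, hdiag, heq, hsymm, hconn⟩ := hA
  refine ⟨⟨fun i j => hnonneg _ _, fun i => ?_⟩, fun i => hdiag _, fun i j k => heq _ _ _,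
    fun i j => hsymm _ _, fun i j => ?_⟩
  · simpa using (Equiv.sum_comp σ (A (σ i))).trans (hrow _)
  · simpa [Function.onFun] using (hconn (σ i) (σ j)).lift σ.symm
      (p := fun a b => 0 < (A.submatrix σ σ) a b) fun a b hab => by
        simpa [Function.onFun] using hab

lemma sum_perm_comp_mul {n : ℕ} (τ : Equiv.Perm (Fin n)) (y : Fin n → ℝ) (i j : Fin n) :
    ∑ σ : Equiv.Perm (Fin n), y (σ (τ i)) * y (σ (τ j)) =
      ∑ σ : Equiv.Perm (Fin n), y (σ i) * y (σ j) :=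
  Equiv.sum_comp (Equiv.mulRight τ) fun σ : Equiv.Perm (Fin n) => y (σ i) * y (σ j)

/-- The diagonal second moments of a uniformly random rearrangement of `y`. -/
lemma card_mul_sum_perm_diag {n : ℕ} (y : Fin n → ℝ) (i : Fin n) :
    n * ∑ σ : Equiv.Perm (Fin n), y (σ i) * y (σ i) = n.factorial * ∑ j, y j * y j := by
  have hconst : ∀ j, ∑ σ : Equiv.Perm (Fin n), y (σ j) * y (σ j) =
      ∑ σ : Equiv.Perm (Fin n), y (σ i) * y (σ i) := fun j => by
    simpa using sum_perm_comp_mul (Equiv.swap i j) y i i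
  calc (n : ℝ) * ∑ σ : Equiv.Perm (Fin n), y (σ i) * y (σ i)
      = ∑ j : Fin n, ∑ σ : Equiv.Perm (Fin n), y (σ j) * y (σ j) := by
        simp [hconst]
    _ = ∑ σ : Equiv.Perm (Fin n), ∑ j, y j * y j := by
        rw [Finset.sum_comm]
        exact Finset.sum_congr rfl fun σ _ => Equiv.sum_comp σ fun j => y j * y j
    _ = n.factorial * ∑ j, y j * y j := by
        simp [Fintype.card_perm]

/-- The second moments of a uniformly random rearrangement of a vector `y` of mean zero. -/
lemma card_mul_sum_perm {n : ℕ} {y : Fin n → ℝ} (hy : ∑ j, y j = 0) (i j : Fin n) :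
    n * (n - 1) * ∑ σ : Equiv.Perm (Fin n), y (σ i) * y (σ j) =
      n.factorial * (∑ k, y k * y k) * (n * (if i = j then 1 else 0) - 1) := by
  have hdiag := card_mul_sum_perm_diag y i
  split_ifs with hij
  · subst hij
    linear_combination (n - 1 : ℝ) * hdiag
  · have hoff : ∀ k ∈ Finset.univ.erase i, ∑ σ : Equiv.Perm (Fin n), y (σ i) * y (σ k) =
        ∑ σ : Equiv.Perm (Fin n), y (σ i) * y (σ j) := fun k hk => by
      have h := sum_perm_comp_mul (Equiv.swap j k) y i j
      rwa [Equiv.swap_apply_left,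
        Equiv.swap_apply_of_ne_of_ne hij (Finset.ne_of_mem_erase hk).symm] at h
    have hrow : ∑ k, ∑ σ : Equiv.Perm (Fin n), y (σ i) * y (σ k) = 0 := by
      rw [Finset.sum_comm]
      refine Finset.sum_eq_zero fun σ _ => ?_
      rw [← Finset.mul_sum, Equiv.sum_comp σ y, hy, mul_zero]
    rw [← Finset.add_sum_erase _ _ (Finset.mem_univ i), Finset.sum_congr rfl hoff,
      Finset.sum_const, Finset.card_erase_of_mem (Finset.mem_univ i), Finset.card_univ,
      Fintype.card_fin, nsmul_eq_mul, Nat.cast_sub (Nat.one_le_of_lt i.pos), Nat.cast_one] at hrow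
    linear_combination (n : ℝ) * hrow - hdiag

/-- Averaged over all rearrangements, a quadratic form that vanishes on constants is a multiple
of the sample variance. -/
lemma sum_perm_quadratic {n : ℕ} {M : Matrix (Fin n) (Fin n) ℝ}
    (hM : M *ᵥ (fun _ => (1 : ℝ)) = 0) {y : Fin n → ℝ} (hy : ∑ j, y j = 0) :
    n * (n - 1) * ∑ σ : Equiv.Perm (Fin n), (y ∘ σ) ⬝ᵥ (M *ᵥ (y ∘ σ)) =
      n.factorial * (∑ k, y k * y k) * (n * M.trace) := by
  have hrow : ∀ i, ∑ j, M i j = 0 := fun i => by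
    simpa [mulVec, dotProduct] using congrFun hM i
  calc (n : ℝ) * (n - 1) * ∑ σ : Equiv.Perm (Fin n), (y ∘ σ) ⬝ᵥ (M *ᵥ (y ∘ σ))
      = n * (n - 1) * ∑ i, ∑ j, M i j * ∑ σ : Equiv.Perm (Fin n), y (σ i) * y (σ j) := by
        congr 1
        simp only [dotProduct, mulVec, Finset.mul_sum, Function.comp_apply]
        rw [Finset.sum_comm]
        refine Finset.sum_congr rfl fun i _ => ?_
        rw [Finset.sum_comm]
        exact Finset.sum_congr rfl fun j _ => Finset.sum_congr rfl fun σ _ => by ring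
    _ = ∑ i, ∑ j, M i j * (n * (n - 1) * ∑ σ : Equiv.Perm (Fin n), y (σ i) * y (σ j)) := by
        rw [Finset.mul_sum]
        refine Finset.sum_congr rfl fun i _ => ?_
        rw [Finset.mul_sum]
        exact Finset.sum_congr rfl fun j _ => by ring
    _ = ∑ i, n.factorial * (∑ k, y k * y k) * (n * M i i) := by
        refine Finset.sum_congr rfl fun i _ => ?_
        have : ∀ j, M i j * (n * (n - 1) * ∑ σ : Equiv.Perm (Fin n), y (σ i) * y (σ j)) =
            n.factorial * (∑ k, y k * y k) * (n * (if i = j then M i j else 0) - M i j) :=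
          fun j => by
            rw [card_mul_sum_perm hy]
            split_ifs <;> ring
        rw [Finset.sum_congr rfl fun j _ => this j, ← Finset.mul_sum, Finset.sum_sub_distrib,
          ← Finset.mul_sum, hrow]
        simp
    _ = n.factorial * (∑ k, y k * y k) * (n * M.trace) := by
        simp only [trace, diag_apply, Finset.mul_sum]

/-- If `𝒬` is nonempty, no matrix of `𝒜` increases the variance of a vector of mean zero whose
image also has mean zero. -/
lemma MemQ.sum_sq_le {n : ℕ} (hn : 2 ≤ n) {M : Matrix (Fin n) (Fin n) ℝ} (hM : MemQ M)
    {A : Matrix (Fin n) (Fin n) ℝ} (hA : MemA A) {x : Fin n → ℝ} (hx : ∑ i, x i = 0)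
    (hAx : ∑ i, (A *ᵥ x) i = 0) :
    ∑ i, (A *ᵥ x) i * (A *ᵥ x) i ≤ ∑ i, x i * x i := by
  obtain ⟨hne, -, hpsd, hone, hle⟩ := hM
  have htrace : 0 < M.trace :=
    hpsd.trace_nonneg.lt_of_ne' fun h => hne (hpsd.trace_eq_zero_iff.mp h)
  have hn' : (2 : ℝ) ≤ n := by exact_mod_cast hn
  have havg : ∑ σ : Equiv.Perm (Fin n), ((A *ᵥ x) ∘ σ) ⬝ᵥ (M *ᵥ ((A *ᵥ x) ∘ σ)) ≤
      ∑ σ : Equiv.Perm (Fin n), (x ∘ σ) ⬝ᵥ (M *ᵥ (x ∘ σ)) := by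
    refine Finset.sum_le_sum fun σ _ => ?_
    have h := hle _ (hA.submatrix σ) (x ∘ σ)
    rwa [submatrix_mulVec_equiv, Function.comp_assoc, Equiv.self_comp_symm,
      Function.comp_id] at h
  have h := mul_le_mul_of_nonneg_left havg (by nlinarith : (0 : ℝ) ≤ n * (n - 1))
  rw [sum_perm_quadratic hone hAx, sum_perm_quadratic hone hx] at h
  have hfac : (0 : ℝ) < n.factorial := by exact_mod_cast n.factorial_pos
  exact le_of_mul_le_mul_left (le_of_mul_le_mul_right h (by positivity)) hfac

/-! ### Equal-neighbor matrices -/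

/-- The equal-neighbor averaging matrix of a reflexive relation `r`. -/
noncomputable def equalNeighbor {n : ℕ} (r : Fin n → Fin n → Prop) [DecidableRel r] :
    Matrix (Fin n) (Fin n) ℝ :=
  fun i j => if r i j then (∑ k, if r i k then (1 : ℝ) else 0)⁻¹ else 0

section EqualNeighbor

variable {n : ℕ} {r : Fin n → Fin n → Prop} [DecidableRel r]

lemma degree_pos (hrefl : ∀ i, r i i) (i : Fin n) : 0 < ∑ k, if r i k then (1 : ℝ) else 0 :=
  Finset.sum_pos' (fun k _ => by split_ifs <;> norm_num)
    ⟨i, Finset.mem_univ i, by simp [hrefl i]⟩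

lemma equalNeighbor_pos_iff (hrefl : ∀ i, r i i) (i j : Fin n) :
    0 < equalNeighbor r i j ↔ r i j := by
  have := degree_pos hrefl i
  unfold equalNeighbor
  split_ifs with h
  · exact iff_of_true (inv_pos.mpr this) h
  · exact iff_of_false (lt_irrefl _) h

lemma equalNeighbor_mulVec (x : Fin n → ℝ) (i : Fin n) :
    (equalNeighbor r *ᵥ x) i =
      (∑ j, if r i j then x j else 0) / ∑ k, if r i k then (1 : ℝ) else 0 := by
  rw [div_eq_inv_mul, Finset.mul_sum]
  simp only [mulVec, dotProduct, equalNeighbor]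
  exact Finset.sum_congr rfl fun j _ => by split_ifs <;> simp

lemma memA_equalNeighbor (hrefl : ∀ i, r i i) (hsymm : ∀ i j, r i j → r j i)
    (hconn : ∀ i j, Relation.ReflTransGen r i j) : MemA (equalNeighbor r) := by
  have hpos := equalNeighbor_pos_iff hrefl
  refine ⟨⟨fun i j => ?_, fun i => ?_⟩, fun i => (hpos i i).2 (hrefl i), fun i j k hj hk => ?_,
    fun i j => ?_, fun i j => ?_⟩
  · by_cases h : r i j
    · exact ((hpos i j).2 h).le
    · simp [equalNeighbor, h]
  · have h := equalNeighbor_mulVec (r := r) (fun _ => 1) i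
    rw [div_self (degree_pos hrefl i).ne'] at h
    simpa [mulVec, dotProduct] using h
  · simp [equalNeighbor, (hpos i j).1 hj, (hpos i k).1 hk]
  · rw [hpos, hpos]
    exact ⟨hsymm i j, hsymm j i⟩
  · simpa only [hpos] using hconn i j

end EqualNeighbor

/-! ### A graph on which averaging increases the variance -/

/-- Two adjacent hubs `0` and `1`, with leaves `2, 3, 4` and `5, 6, 7` respectively. Node `8`
is adjacent to both hubs, and all further nodes are adjacent to node `8`. -/
abbrev TwoHubEdge (a b : ℕ) : Prop :=
  (a = 0 ∧ (b = 1 ∨ (2 ≤ b ∧ b ≤ 4) ∨ b = 8)) ∨ (a = 1 ∧ 5 ≤ b ∧ b ≤ 8) ∨ (a = 8 ∧ 9 ≤ b)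

/-- The reflexive and symmetric closure of `TwoHubEdge`. -/
abbrev TwoHubAdj (a b : ℕ) : Prop :=
  a = b ∨ TwoHubEdge a b ∨ TwoHubEdge b a

/-- The vector with values `±h` at the hubs, `±c` at their leaves, and `0` elsewhere. -/
def twoHubVec (h c : ℝ) (i : ℕ) : ℝ :=
  if i = 0 then h else if i = 1 then -h else if i ≤ 4 then c else if i ≤ 7 then -c else 0

/-- The equal-neighbor matrix of the two-hub graph on `n` nodes. -/
noncomputable def twoHubMatrix (n : ℕ) : Matrix (Fin n) (Fin n) ℝ :=
  equalNeighbor fun i j : Fin n => TwoHubAdj i j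

lemma twoHubAdj_refl (i : ℕ) : TwoHubAdj i i := Or.inl rfl

lemma twoHubAdj_symm {i j : ℕ} (h : TwoHubAdj i j) : TwoHubAdj j i :=
  h.elim (fun h => Or.inl h.symm) fun h => Or.inr h.symm

lemma twoHub_connected {n : ℕ} (hn : 8 ≤ n) (i j : Fin n) :
    Relation.ReflTransGen (fun a b : Fin n => TwoHubAdj a b) i j := by
  have key : ∀ i : Fin n,
      Relation.ReflTransGen (fun a b : Fin n => TwoHubAdj a b) ⟨0, by omega⟩ i := by
    intro i
    by_cases h9 : 9 ≤ (i : ℕ)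
    · have h8 : 8 < n := by omega
      exact (Relation.ReflTransGen.single (b := (⟨8, h8⟩ : Fin n))
          (by simp [TwoHubAdj, TwoHubEdge])).tail
        (Or.inr (Or.inl (Or.inr (Or.inr ⟨rfl, h9⟩))))
    · by_cases h5 : 5 ≤ (i : ℕ)
      · exact (Relation.ReflTransGen.single (b := (⟨1, by omega⟩ : Fin n))
          (by simp [TwoHubAdj, TwoHubEdge])).tail
          (Or.inr (Or.inl (Or.inr (Or.inl ⟨rfl, h5, by omega⟩))))
      · refine Relation.ReflTransGen.single ?_
        show TwoHubAdj 0 i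
        unfold TwoHubAdj TwoHubEdge
        omega
  have : Std.Symm (fun a b : Fin n => TwoHubAdj a b) := ⟨fun _ _ => twoHubAdj_symm⟩
  exact (Std.Symm.symm _ _ (key i)).trans (key j)

lemma memA_twoHubMatrix {n : ℕ} (hn : 8 ≤ n) : MemA (twoHubMatrix n) :=
  memA_equalNeighbor (fun _ => twoHubAdj_refl _) (fun _ _ => twoHubAdj_symm)
    (twoHub_connected hn)

/-- A sum over `n ≥ 8` nodes, with the first eight terms written out. -/
lemma sum_fin_eight_add {n : ℕ} (hn : 8 ≤ n) (f : ℕ → ℝ) :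
    ∑ i : Fin n, f i = f 0 + f 1 + f 2 + f 3 + f 4 + f 5 + f 6 + f 7 +
      ∑ k ∈ Finset.range (n - 8), f (8 + k) := by
  obtain ⟨m, rfl⟩ := Nat.exists_eq_add_of_le hn
  rw [Fin.sum_univ_eq_sum_range, Finset.sum_range_add, Nat.add_sub_cancel_left]
  simp [Finset.sum_range_succ]

lemma twoHubVec_of_eight_le (h c : ℝ) {i : ℕ} (hi : 8 ≤ i) : twoHubVec h c i = 0 := by
  unfold twoHubVec
  split_ifs <;> first | omega | rfl

lemma sum_twoHubVec {n : ℕ} (hn : 8 ≤ n) (h c : ℝ) : ∑ i : Fin n, twoHubVec h c i = 0 := by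
  rw [sum_fin_eight_add hn, Finset.sum_eq_zero fun k _ => twoHubVec_of_eight_le h c (by omega)]
  simp [twoHubVec]

lemma sum_twoHubVec_sq {n : ℕ} (hn : 8 ≤ n) (h c : ℝ) :
    ∑ i : Fin n, twoHubVec h c i * twoHubVec h c i = 2 * (h * h) + 6 * (c * c) := by
  rw [sum_fin_eight_add hn fun i => twoHubVec h c i * twoHubVec h c i,
    Finset.sum_eq_zero fun k _ => by rw [twoHubVec_of_eight_le h c (by omega), zero_mul]]
  simp [twoHubVec]
  ring

/-- One averaging step on the two-hub graph, started with values `±1` at the hubs and `±2/5` at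
the leaves. -/
lemma twoHubMatrix_mulVec {n : ℕ} (hn : 8 ≤ n) : ∃ h : ℝ, 1 / 5 ≤ h ∧
    (twoHubMatrix n *ᵥ fun i => twoHubVec 1 (2 / 5) i) =
      fun i : Fin n => twoHubVec h (7 / 10) i := by
  set t : ℝ := ∑ k ∈ Finset.range (n - 8), if k = 0 then (1 : ℝ) else 0 with ht
  have ht' : 0 ≤ t ∧ t ≤ 1 := by
    rw [ht, Finset.sum_ite_eq']
    split_ifs <;> norm_num
  refine ⟨6 / 5 / (5 + t), ?_, ?_⟩
  · rw [le_div_iff₀ (by linarith)]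
    linarith
  ext i
  rw [twoHubMatrix, equalNeighbor_mulVec,
    sum_fin_eight_add hn fun j => if TwoHubAdj i j then twoHubVec 1 (2 / 5) j else 0,
    Finset.sum_eq_zero fun k _ => by rw [twoHubVec_of_eight_le _ _ (by omega), ite_self],
    sum_fin_eight_add hn fun j => if TwoHubAdj i j then (1 : ℝ) else 0]
  generalize (i : ℕ) = a
  rcases lt_or_ge a 8 with ha | ha
  · have hfar : ∀ a k, 2 ≤ a → a < 8 → ¬ TwoHubAdj a (8 + k) := by
      unfold TwoHubAdj TwoHubEdge
      omega
    have hhub : ∀ a k, a < 2 → (TwoHubAdj a (8 + k) ↔ k = 0) := by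
      unfold TwoHubAdj TwoHubEdge
      omega
    interval_cases a
    all_goals first
      | simp only [hhub _ _ (by norm_num : 0 < 2), hhub _ _ (by norm_num : 1 < 2), ← ht]
      | simp only [hfar _ _ (by norm_num) ha]
    all_goals
      norm_num [TwoHubAdj, TwoHubEdge, twoHubVec]
      try ring
  · have h0 : TwoHubAdj a 0 ↔ TwoHubAdj a 1 := by
      unfold TwoHubAdj TwoHubEdge
      omega
    have hleaf : ∀ b, 2 ≤ b → b < 8 → ¬ TwoHubAdj a b := by
      unfold TwoHubAdj TwoHubEdge
      omega
    rw [twoHubVec_of_eight_le _ _ ha, if_neg (hleaf 2 (by norm_num) (by norm_num)),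
      if_neg (hleaf 3 (by norm_num) (by norm_num)), if_neg (hleaf 4 (by norm_num) (by norm_num)),
      if_neg (hleaf 5 (by norm_num) (by norm_num)), if_neg (hleaf 6 (by norm_num) (by norm_num)),
      if_neg (hleaf 7 (by norm_num) (by norm_num))]
    simp only [h0]
    split_ifs <;> simp [twoHubVec]

/-- **Theorem (main result).** For `n ≥ 8` the class `𝒬` is empty: there is no nonzero,
symmetric, positive semidefinite matrix `M` with `Me = 0` that satisfies
`xᵀAᵀMAx ≤ xᵀMx` for every `A ∈ 𝒜` and every `x ∈ ℝⁿ`. -/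
theorem no_quadratic_lyapunov (n : ℕ) (hn : 8 ≤ n) :
    ¬ ∃ M : Matrix (Fin n) (Fin n) ℝ, MemQ M := by
  rintro ⟨M, hM⟩
  obtain ⟨h, hh, hAx⟩ := twoHubMatrix_mulVec hn
  have hle := hM.sum_sq_le (by omega) (memA_twoHubMatrix hn) (sum_twoHubVec hn 1 (2 / 5))
    (by rw [hAx]; exact sum_twoHubVec hn h (7 / 10))
  rw [hAx, sum_twoHubVec_sq hn, sum_twoHubVec_sq hn] at hle
  nlinarith
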